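/- Let D be a t-doublesharp PvMD, i.e., a PvMD in which every nonzero prime t-ideal is t-sharp. If P is a nonzero prime t-ideal of D that is not t-maximal, then P is divisorial: (P⁻¹)⁻¹ = P. -/

import Mathlib

/-! Statement 16: Let D be a t-doublesharp PvMD (every nonzero prime t-ideal is t-sharp). If P is a nonzero prime t-ideal which is not t-maximal, then P is divisorial. -/

noncomputable section

/-- The image of an ideal of `D` in the fraction field of `D`, as a `D`-submodule. -/
def coeI (D : Type*) [CommRing D] [IsDomain D] (I : Ideal D) :
    Submodule D (FractionRing D) :=
  Submodule.map (Algebra.linearMap D (FractionRing D)) I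

/-- The `v`-operation on `D`-submodules of the fraction field `K`:
`E^v = (E⁻¹)⁻¹`, where `E⁻¹ = (D : E) = {x ∈ K : xE ⊆ D}`. -/
def vSub (D : Type*) [CommRing D] [IsDomain D] (E : Submodule D (FractionRing D)) :
    Submodule D (FractionRing D) :=
  1 / (1 / E)

/-- The `t`-operation: `E^t = ⋃ {F^v : F` a nonzero finitely generated submodule `⊆ E}`,
as a subset of the fraction field. -/
def tSet (D : Type*) [CommRing D] [IsDomain D] (E : Submodule D (FractionRing D)) :
    Set (FractionRing D) :=
  ⋃ F ∈ {F : Submodule D (FractionRing D) | F.FG ∧ F ≠ ⊥ ∧ F ≤ E},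
    (vSub D F : Set (FractionRing D))

/-- An integral ideal `I` of `D` is a `t`-ideal if `I^t = I`. -/
def IsTIdeal (D : Type*) [CommRing D] [IsDomain D] (I : Ideal D) : Prop :=
  tSet D (coeI D I) = (coeI D I : Set (FractionRing D))

/-- A nonzero ideal `I` of `D` is `t`-idempotent if `(I²)^t = I^t`. -/
def TIdem (D : Type*) [CommRing D] [IsDomain D] (I : Ideal D) : Prop :=
  tSet D (coeI D (I * I)) = tSet D (coeI D I)

/-- `D` is a Prüfer `v`-multiplication domain: `(F·F⁻¹)^t = D` for every nonzero
finitely generated ideal `F` of `D`. -/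
def IsPvMD (D : Type*) [CommRing D] [IsDomain D] : Prop :=
  ∀ F : Ideal D, F ≠ ⊥ → F.FG →
    tSet D (coeI D F * (1 / coeI D F)) =
      ((1 : Submodule D (FractionRing D)) : Set (FractionRing D))

/-- A `t`-maximal ideal: an ideal maximal among proper integral `t`-ideals. -/
def IsTMax (D : Type*) [CommRing D] [IsDomain D] (M : Ideal D) : Prop :=
  M ≠ ⊤ ∧ IsTIdeal D M ∧ ∀ J : Ideal D, J ≠ ⊤ → IsTIdeal D J → M ≤ J → J = M

/-- The localization `D_P` of `D` at a prime `P`, viewed as a subset of the fraction field: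
the set of fractions `a / s` with `s ∉ P`. -/
def locSet (D : Type*) [CommRing D] [IsDomain D] (P : Ideal D) : Set (FractionRing D) :=
  {x | ∃ a s : D, s ∉ P ∧ x * algebraMap D (FractionRing D) s = algebraMap D (FractionRing D) a}

/-- A prime `t`-ideal `P` is `t`-sharp if `⋂ {D_M : M t-maximal, M ⊉ P} ⊄ D_P`. -/
def IsTSharp (D : Type*) [CommRing D] [IsDomain D] (P : Ideal D) : Prop :=
  ¬ (⋂ M ∈ {M : Ideal D | IsTMax D M ∧ ¬ P ≤ M}, locSet D M) ⊆ locSet D P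

/-- A prime ideal `P` of `D` is branched if there is a `P`-primary ideal distinct from `P`. -/
def IsBranched (D : Type*) [CommRing D] [IsDomain D] (P : Ideal D) : Prop :=
  ∃ Q : Ideal D, Q.IsPrimary ∧ Q.radical = P ∧ Q ≠ P

/-- `D` has finite `t`-character: every nonzero element lies in only finitely many
`t`-maximal ideals. -/
def FiniteTCharacter (D : Type*) [CommRing D] [IsDomain D] : Prop :=
  ∀ a : D, a ≠ 0 → {M : Ideal D | IsTMax D M ∧ a ∈ M}.Finite

/-- A nonzero ideal `I` of `D` is divisorial if `(I⁻¹)⁻¹ = I`. -/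
def IsDivisorial (D : Type*) [CommRing D] [IsDomain D] (I : Ideal D) : Prop :=
  vSub D (coeI D I) = coeI D I


section Aux

variable {D : Type*} [CommRing D]

local notation "K" => FractionRing D

local notation "ι" => algebraMap D (FractionRing D)

theorem exists_pow_mul_mem_of_mem_minimalPrimes {I Q : Ideal D} (hQ : Q ∈ I.minimalPrimes)
    {c : D} (hc : c ∈ Q) : ∃ n : ℕ, ∃ u ∉ Q, c ^ n * u ∈ I := by
  have hQp : Q.IsPrime := hQ.1.1
  by_contra! hcon
  have hdis : Disjoint (I : Set D) (Submonoid.powers c ⊔ Q.primeCompl : Submonoid D) := by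
    rw [Set.disjoint_left]
    intro z hz hz'
    obtain ⟨_, ⟨n, rfl⟩, u, hu, rfl⟩ := Submonoid.mem_sup.1 hz'
    exact hcon n u hu hz
  obtain ⟨p, hp, hIp, hpd⟩ := Ideal.exists_le_prime_disjoint I _ hdis
  have hpQ : p ≤ Q := fun z hz => by
    by_contra hzQ
    exact Set.disjoint_left.1 hpd hz (Submonoid.mem_sup_right (T := Q.primeCompl) hzQ)
  exact Set.disjoint_left.1 hpd (hQ.2 ⟨hp, hIp⟩ hpQ hc)
    (Submonoid.mem_sup_left (Submonoid.mem_powers c))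

theorem algebraMap_mem_one (a : D) : ι a ∈ (1 : Submodule D K) :=
  Submodule.mem_one.2 ⟨a, rfl⟩

variable [IsDomain D]

theorem mem_coeI {I : Ideal D} {a : D} : ι a ∈ coeI D I ↔ a ∈ I := by
  unfold coeI
  rw [Submodule.mem_map]
  constructor
  · rintro ⟨b, hb, h⟩
    rwa [← IsFractionRing.injective D K h]
  · exact fun h => ⟨a, h, rfl⟩

theorem mem_one_div_coeI {I : Ideal D} {y : K} :
    y ∈ 1 / coeI D I ↔ ∀ a ∈ I, y * ι a ∈ (1 : Submodule D K) := by
  rw [Submodule.mem_div_iff_forall_mul_mem]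
  constructor
  · exact fun h a ha => h _ (mem_coeI.2 ha)
  · rintro h _ ⟨a, ha, rfl⟩
    exact h a ha

theorem mem_vSub {E : Submodule D K} {x : K} :
    x ∈ vSub D E ↔ ∀ y ∈ 1 / E, x * y ∈ (1 : Submodule D K) :=
  Submodule.mem_div_iff_forall_mul_mem

theorem le_vSub (E : Submodule D K) : E ≤ vSub D E := fun x hx =>
  mem_vSub.2 fun y hy => by
    rw [mul_comm]
    exact Submodule.mem_div_iff_forall_mul_mem.1 hy x hx

theorem vSub_coeI_le_one (I : Ideal D) : vSub D (coeI D I) ≤ 1 := fun x hx => by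
  have h := mem_vSub.1 hx 1 (mem_one_div_coeI.2 fun a _ => by
    rw [one_mul]; exact algebraMap_mem_one a)
  rwa [mul_one] at h

theorem exists_eq_coeI {I : Ideal D} {F : Submodule D K} (hF : F ≤ coeI D I) :
    ∃ J ≤ I, F = coeI D J := by
  refine ⟨F.comap (Algebra.linearMap D K), fun a ha => mem_coeI.1 (hF ha), ?_⟩
  unfold coeI
  rw [Submodule.map_comap_eq_self]
  exact hF.trans (LinearMap.map_le_range)

theorem coeI_eq_bot {I : Ideal D} : coeI D I = ⊥ ↔ I = ⊥ :=
  (Submodule.map_injective_of_injective (f := Algebra.linearMap D K)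
    (IsFractionRing.injective D K)).eq_iff' (Submodule.map_bot _)

theorem coeI_fg {I : Ideal D} : (coeI D I).FG ↔ I.FG :=
  Submodule.fg_map_iff (f := Algebra.linearMap D K) (IsFractionRing.injective D K)

theorem coeI_mono {I J : Ideal D} (h : I ≤ J) : coeI D I ≤ coeI D J :=
  Submodule.map_mono h

theorem isTIdeal_iff {I : Ideal D} :
    IsTIdeal D I ↔ I ≠ ⊥ ∧ ∀ F : Ideal D, F.FG → F ≠ ⊥ → F ≤ I →
      ∀ a : D, ι a ∈ vSub D (coeI D F) → a ∈ I := by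
  unfold IsTIdeal
  constructor
  · intro h
    refine ⟨?_, fun F hF hF0 hFI a ha => ?_⟩
    · rintro rfl
      have h0 : ι (0 : D) ∈ (coeI D (⊥ : Ideal D) : Set K) := mem_coeI.2 (Ideal.zero_mem _)
      rw [← h] at h0
      simp only [tSet, Set.mem_iUnion, Set.mem_ofPred_eq] at h0
      obtain ⟨F, ⟨-, hF, hle⟩, -⟩ := h0
      rw [coeI_eq_bot.2 rfl] at hle
      exact hF (le_bot_iff.1 hle)
    · rw [← mem_coeI, ← SetLike.mem_coe, ← h]
      simp only [tSet, Set.mem_iUnion, Set.mem_ofPred_eq]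
      exact ⟨coeI D F, ⟨coeI_fg.2 hF, mt coeI_eq_bot.1 hF0, coeI_mono hFI⟩, ha⟩
  · rintro ⟨hI, h⟩
    ext x
    simp only [tSet, Set.mem_iUnion, Set.mem_ofPred_eq, SetLike.mem_coe]
    constructor
    · rintro ⟨F, ⟨hF, hF0, hFI⟩, hx⟩
      obtain ⟨J, hJI, rfl⟩ := exists_eq_coeI hFI
      obtain ⟨a, rfl⟩ := Submodule.mem_one.1 (vSub_coeI_le_one J hx)
      exact mem_coeI.2 (h J (coeI_fg.1 hF) (mt coeI_eq_bot.2 hF0) hJI a hx)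
    · rintro ⟨a, ha, rfl⟩
      obtain ⟨b, hb, hb0⟩ := Submodule.exists_mem_ne_zero_of_ne_bot hI
      refine ⟨coeI D (Ideal.span {a, b}), ⟨coeI_fg.2 (Submodule.fg_span (Set.toFinite _)), ?_, coeI_mono ?_⟩, ?_⟩
      · rw [ne_eq, coeI_eq_bot]
        intro hbot
        have : b ∈ Ideal.span {a, b} := Ideal.subset_span (by simp)
        rw [hbot] at this
        exact hb0 this
      · rw [Ideal.span_le]
        rintro c (rfl | rfl)
        exacts [ha, hb]
      · exact le_vSub _ (mem_coeI.2 (Ideal.subset_span (by simp)))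

/-- Finitely generated ideals are `t`-invertible, so `F·F⁻¹` lies in no proper `t`-ideal. -/
theorem IsPvMD.exists_mul_notMem (h : IsPvMD D) {M F : Ideal D} (hM : M ≠ ⊤)
    (hMt : IsTIdeal D M) (hF0 : F ≠ ⊥) (hF : F.FG) :
    ∃ f ∈ F, ∃ y ∈ 1 / coeI D F, ∃ u ∉ M, ι u = y * ι f := by
  by_contra! hcon
  have hle : coeI D F * (1 / coeI D F) ≤ coeI D M := by
    rw [Submodule.mul_le]
    rintro _ ⟨f, hf, rfl⟩ y hy
    obtain ⟨u, hu⟩ := Submodule.mem_one.1 (mem_one_div_coeI.1 hy f hf)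
    change ι f * y ∈ _
    rw [mul_comm, ← hu, mem_coeI]
    by_contra huM
    exact hcon f hf y hy u huM hu
  have h1 : (1 : K) ∈ ((1 : Submodule D K) : Set K) := Submodule.one_le.1 le_rfl
  rw [← h F hF0 hF] at h1
  have h2 : (1 : K) ∈ tSet D (coeI D M) := by
    simp only [tSet, Set.mem_iUnion, Set.mem_ofPred_eq] at h1 ⊢
    obtain ⟨G, ⟨hG, hG0, hGle⟩, hx⟩ := h1
    exact ⟨G, ⟨hG, hG0, hGle.trans hle⟩, hx⟩
  rw [hMt, ← map_one (algebraMap D K)] at h2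
  exact hM ((Ideal.eq_top_iff_one M).2 (mem_coeI.1 h2))

/-- The localization of a PvMD at a prime `t`-ideal is a valuation ring. -/
theorem IsPvMD.exists_mul_eq_mul (h : IsPvMD D) {M : Ideal D} (hM : M.IsPrime)
    (hMt : IsTIdeal D M) (a b : D) :
    ∃ c, ∃ s ∉ M, b * s = a * c ∨ a * s = b * c := by
  by_cases hab : Ideal.span {a, b} = ⊥
  · rw [Ideal.span_eq_bot] at hab
    refine ⟨0, 1, hM.one_notMem, Or.inl ?_⟩
    rw [hab a (by simp), hab b (by simp)]
    simp
  obtain ⟨f, hf, y, hy, u, hu, huf⟩ :=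
    h.exists_mul_notMem hM.ne_top hMt hab (Submodule.fg_span (Set.toFinite _))
  rw [mem_one_div_coeI] at hy
  obtain ⟨p, hp⟩ := Submodule.mem_one.1 (hy a (Ideal.subset_span (by simp)))
  obtain ⟨q, hq⟩ := Submodule.mem_one.1 (hy b (Ideal.subset_span (by simp)))
  have key : b * p = a * q := by
    apply IsFractionRing.injective D K
    rw [map_mul, map_mul, hp, hq]
    ring
  obtain ⟨r, t, rfl⟩ := Ideal.mem_span_pair.1 hf
  have hu' : u = r * p + t * q := by
    apply IsFractionRing.injective D K
    rw [huf]
    simp only [map_add, map_mul, hp, hq]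
    ring
  by_cases hpM : p ∈ M
  · refine ⟨p, q, fun hqM => hu ?_, Or.inr key.symm⟩
    rw [hu']
    exact M.add_mem (M.mul_mem_left _ hpM) (M.mul_mem_left _ hqM)
  · exact ⟨q, p, hpM, Or.inl key⟩

/-- In a PvMD, a nonzero prime contained in a proper `t`-ideal is a `t`-ideal. -/
theorem IsPvMD.isTIdeal_of_le (h : IsPvMD D) {Q M : Ideal D} (hQ : Q.IsPrime) (hQ0 : Q ≠ ⊥)
    (hM : M ≠ ⊤) (hMt : IsTIdeal D M) (hQM : Q ≤ M) : IsTIdeal D Q := by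
  refine isTIdeal_iff.2 ⟨hQ0, fun F hF hF0 hFQ a ha => ?_⟩
  obtain ⟨f, hf, y, hy, u, hu, huf⟩ := h.exists_mul_notMem hM hMt hF0 hF
  obtain ⟨d, hd⟩ := Submodule.mem_one.1 (mem_vSub.1 ha y hy)
  have : a * u = d * f := by
    apply IsFractionRing.injective D K
    rw [map_mul, map_mul, hd, huf]
    ring
  exact (hQ.mem_or_mem (this ▸ Q.mul_mem_left d (hFQ hf))).resolve_right fun huQ => hu (hQM huQ)

theorem IsTIdeal.exists_isTMax {I : Ideal D} (hI : I ≠ ⊤) (hIt : IsTIdeal D I) :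
    ∃ M, IsTMax D M ∧ I ≤ M := by
  obtain ⟨M, hIM, hM⟩ := zorn_le_nonempty₀ {J : Ideal D | J ≠ ⊤ ∧ IsTIdeal D J}
    (fun c hc hch J hJ => by
      have hdir : DirectedOn (· ≤ ·) c := hch.directedOn
      refine ⟨sSup c, ⟨?_, isTIdeal_iff.2 ⟨?_, fun F hF hF0 hFc a ha => ?_⟩⟩,
        fun z hz => le_sSup hz⟩
      · rw [ne_eq, Ideal.eq_top_iff_one, Submodule.mem_sSup_of_directed ⟨J, hJ⟩ hdir]
        rintro ⟨L, hL, h1⟩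
        exact (hc hL).1 ((Ideal.eq_top_iff_one L).2 h1)
      · exact fun hbot => (isTIdeal_iff.1 (hc hJ).2).1 (le_bot_iff.1 (hbot ▸ le_sSup hJ))
      · obtain ⟨L, hL, hFL⟩ := (CompleteLattice.isCompactElement_iff_le_of_directed_sSup_le _ F).1
          ((Submodule.fg_iff_compact F).1 hF) c ⟨J, hJ⟩ hdir hFc
        exact le_sSup hL ((isTIdeal_iff.1 (hc hL).2).2 F hF hF0 hFL a ha)) I ⟨hI, hIt⟩
  exact ⟨M, ⟨hM.prop.1, hM.prop.2, fun J hJ hJt hMJ => (hM.eq_of_le ⟨hJ, hJt⟩ hMJ).symm⟩, hIM⟩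

theorem IsTMax.isPrime {M : Ideal D} (hM : IsTMax D M) : M.IsPrime := by
  refine ⟨hM.1, fun {a b} hab => ?_⟩
  by_cases hb : b = 0
  · exact Or.inr (hb ▸ M.zero_mem)
  by_contra! hcon
  have hMt := isTIdeal_iff.1 hM.2.1
  set J : Ideal D := Submodule.comap (LinearMap.mulLeft D b) M
  have memJ (x : D) : x ∈ J ↔ b * x ∈ M := Iff.rfl
  have hMJ : M ≤ J := fun x hx => M.mul_mem_left b hx
  have hJt : IsTIdeal D J := by
    refine isTIdeal_iff.2 ⟨fun h => hMt.1 (le_bot_iff.1 (h ▸ hMJ)), fun F hF hF0 hFJ x hx => ?_⟩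
    have hinj : Function.Injective (LinearMap.mulLeft D b) := mul_right_injective₀ hb
    refine hMt.2 (Submodule.map (LinearMap.mulLeft D b) F) (Submodule.FG.map _ hF) (fun h => hF0 ?_) ?_ _ ?_
    · exact ((Submodule.map_injective_of_injective hinj).eq_iff' (Submodule.map_bot _)).1 h
    · exact Submodule.map_le_iff_le_comap.2 hFJ
    · refine mem_vSub.2 fun y hy => ?_
      rw [mem_one_div_coeI] at hy
      have := mem_vSub.1 hx (ι b * y) (mem_one_div_coeI.2 fun f hf => by
        have := hy (b * f) ⟨f, hf, rfl⟩
        rw [map_mul] at this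
        convert this using 1
        ring)
      rw [LinearMap.mulLeft_apply, map_mul]
      convert this using 1
      ring
  have hJtop : J ≠ ⊤ := fun h => hcon.2 (by
    have := (memJ 1).1 (h ▸ Submodule.mem_top)
    rwa [mul_one] at this)
  have haJ : a ∈ J := (memJ a).2 (mul_comm a b ▸ hab)
  exact hcon.1 (hM.2.2 J hJtop hJt hMJ ▸ haJ)

/-- `D` is the intersection of its localizations at `t`-maximal ideals. -/
theorem mem_one_of_forall_isTMax {y : K} (hy : ∀ M, IsTMax D M → y ∈ locSet D M) :
    y ∈ (1 : Submodule D K) := by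
  set J : Ideal D := (1 : Submodule D K).comap (LinearMap.toSpanSingleton D K y)
  have memJ (x : D) : x ∈ J ↔ ι x * y ∈ (1 : Submodule D K) := by
    rw [← Algebra.smul_def]; rfl
  have hJtop : J = ⊤ := by
    by_contra hne
    have hJt : IsTIdeal D J := by
      refine isTIdeal_iff.2 ⟨fun h => ?_, fun F hF hF0 hFJ x hx => ?_⟩
      · obtain ⟨a, s, hs, rfl⟩ := IsFractionRing.div_surjective D y
        have hs0 : s ≠ 0 := nonZeroDivisors.ne_zero hs
        have hsK : ι s ≠ 0 := by simpa using hs0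
        have : s ∈ J := (memJ s).2 (by
          rw [mul_div_cancel₀ _ hsK]; exact algebraMap_mem_one a)
        rw [h] at this
        exact hs0 this
      · refine (memJ x).2 (mem_vSub.1 hx y (mem_one_div_coeI.2 fun f hf => ?_))
        rw [mul_comm]
        exact (memJ f).1 (hFJ hf)
    obtain ⟨M, hM, hJM⟩ := hJt.exists_isTMax hne
    obtain ⟨a, s, hs, h⟩ := hy M hM
    exact hs (hJM ((memJ s).2 (by rw [mul_comm, h]; exact algebraMap_mem_one a)))
  have := (memJ 1).1 (hJtop ▸ Submodule.mem_top)
  rwa [map_one, one_mul] at this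

theorem mul_mem_locSet {P : Ideal D} (hP : P.IsPrime) {x y : K} (hx : x ∈ locSet D P)
    (hy : y ∈ locSet D P) : x * y ∈ locSet D P := by
  obtain ⟨a, s, hs, h⟩ := hx
  obtain ⟨b, t, ht, h'⟩ := hy
  refine ⟨a * b, s * t, fun hst => (hP.mem_or_mem hst).elim hs ht, ?_⟩
  rw [map_mul, map_mul, ← h, ← h']
  ring

theorem mem_locSet_of_mem_one {P : Ideal D} (hP : P.IsPrime) {x : K}
    (hx : x ∈ (1 : Submodule D K)) : x ∈ locSet D P := by
  obtain ⟨a, rfl⟩ := Submodule.mem_one.1 hx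
  exact ⟨a, 1, hP.one_notMem, by simp⟩

theorem pow_mem_locSet {P : Ideal D} (hP : P.IsPrime) {x : K} (hx : x ∈ locSet D P) (n : ℕ) :
    x ^ n ∈ locSet D P := by
  induction n with
  | zero => exact mem_locSet_of_mem_one hP (by rw [pow_zero]; exact Submodule.one_le.1 le_rfl)
  | succ n ih => rw [pow_succ]; exact mul_mem_locSet hP ih hx

/-- In a PvMD, a fraction lying in `D_P` and in `D_N` for every `t`-maximal `N` not
containing `P` multiplies `P` into `D`. -/
theorem IsPvMD.mem_one_div (h : IsPvMD D) {P : Ideal D} (hP : P.IsPrime) {y : K}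
    (hyP : y ∈ locSet D P) (hy : ∀ N, IsTMax D N → ¬ P ≤ N → y ∈ locSet D N) :
    y ∈ 1 / coeI D P := by
  refine mem_one_div_coeI.2 fun p hp => mem_one_of_forall_isTMax fun N hN => ?_
  by_cases hPN : P ≤ N
  · obtain ⟨a, s, hs, e⟩ := hyP
    have hsK : ι s ≠ 0 := fun h0 => hs (by
      rw [IsFractionRing.to_map_eq_zero_iff.1 h0]; exact P.zero_mem)
    obtain ⟨c, t, ht, hc | hc⟩ := h.exists_mul_eq_mul hN.isPrime hN.2.1 (a * p) s
    · have : s * t ∈ P := hc ▸ P.mul_mem_right _ (P.mul_mem_left _ hp)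
      exact absurd this fun hst => (hP.mem_or_mem hst).elim hs fun htP => ht (hPN htP)
    · refine ⟨c, t, ht, mul_left_cancel₀ hsK ?_⟩
      rw [← map_mul ι s c, ← hc, map_mul, map_mul, ← e]
      ring
  · exact mul_mem_locSet hN.isPrime (hy N hN hPN)
      (mem_locSet_of_mem_one hN.isPrime (algebraMap_mem_one p))

/-- In a PvMD, a fraction outside `D_Q` can be modified to be also a denominator of a given
element of `Q`. -/
theorem IsPvMD.exists_notMem_locSet (h : IsPvMD D) {Q : Ideal D} (hQ : Q.IsPrime)
    (hQt : IsTIdeal D Q) {x : D} (hx : x ∈ Q) {z : K} (hz : z ∉ locSet D Q) :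
    ∃ d : D, z * ι d ∉ locSet D Q ∧ z * ι d * ι x ∈ (1 : Submodule D K) := by
  obtain ⟨a, b, hb, rfl⟩ := IsFractionRing.div_surjective D z
  have hbK : ι b ≠ 0 := by simpa using nonZeroDivisors.ne_zero hb
  obtain ⟨c, s, hs, hc | hc⟩ := h.exists_mul_eq_mul hQ hQt (a * x) b
  · have e : ι a / ι b * ι c * ι x = ι s := by
      have := congrArg ι hc
      simp only [map_mul] at this
      field_simp
      rw [this]
      ring
    refine ⟨c, ?_, e ▸ algebraMap_mem_one s⟩
    rintro ⟨r, t, ht, hr⟩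
    have : s * t = x * r := by
      apply IsFractionRing.injective D K
      rw [map_mul, map_mul, ← e, ← hr]
      ring
    exact (hQ.mem_or_mem (this ▸ Q.mul_mem_right r hx)).elim hs ht
  · refine ⟨s, ?_, Submodule.mem_one.2 ⟨c, ?_⟩⟩
    · rintro ⟨r, t, ht, hr⟩
      exact hz ⟨r, s * t, fun hst => (hQ.mem_or_mem hst).elim hs ht, by
        rw [map_mul, ← mul_assoc, hr]⟩
    · have := congrArg ι hc
      simp only [map_mul] at this
      field_simp
      linear_combination -this

/-- If `Q` is minimal over `x`, then powers of a fraction outside `D_Q` eventually carry `x`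
out of `D`. -/
theorem IsPvMD.exists_mul_pow_notMem (h : IsPvMD D) {Q : Ideal D} {x : D}
    (hQ : Q ∈ (Ideal.span {x}).minimalPrimes) (hQt : IsTIdeal D Q) {y : K}
    (hy : y ∉ locSet D Q) : ∃ n : ℕ, ι x * y ^ n ∉ (1 : Submodule D K) := by
  have hQp : Q.IsPrime := hQ.1.1
  obtain ⟨a, b, hb, rfl⟩ := IsFractionRing.div_surjective D y
  have hbK : ι b ≠ 0 := by simpa using nonZeroDivisors.ne_zero hb
  obtain ⟨c, s, hs, hc | hc⟩ := h.exists_mul_eq_mul hQp hQt a b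
  · have e : ι a / ι b * ι c = ι s := by
      have := congrArg ι hc
      simp only [map_mul] at this
      field_simp
      exact this.symm
    by_cases hcQ : c ∈ Q
    · obtain ⟨n, u, hu, hmem⟩ := exists_pow_mul_mem_of_mem_minimalPrimes hQ hcQ
      obtain ⟨d, hd⟩ := Ideal.mem_span_singleton.1 hmem
      refine ⟨n + 1, fun hmem => hy ?_⟩
      obtain ⟨r, hr⟩ := Submodule.mem_one.1 hmem
      refine ⟨d * r, s ^ n * u, fun hsu => (hQp.mem_or_mem hsu).elim
        (fun h' => hs (hQp.mem_of_pow_mem n h')) hu, ?_⟩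
      have hd' := congrArg ι hd
      simp only [map_mul, map_pow] at hd' ⊢
      rw [hr, ← e, mul_pow, mul_assoc _ _ (ι u), hd']
      ring
    · exact absurd ⟨s, c, hcQ, e⟩ hy
  · refine absurd ⟨c, s, hs, ?_⟩ hy
    have := congrArg ι hc
    simp only [map_mul] at this
    field_simp
    exact this

end Aux

theorem statement16 (D : Type*) [CommRing D] [IsDomain D]
    (hPvMD : IsPvMD D)
    (hds : ∀ P : Ideal D, P.IsPrime → P ≠ ⊥ → IsTIdeal D P → IsTSharp D P)
    (P : Ideal D) (hP : P.IsPrime) (hP0 : P ≠ ⊥) (hPt : IsTIdeal D P)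
    (hPnm : ¬ IsTMax D P) :
    vSub D (coeI D P) = coeI D P := by
  refine le_antisymm (fun w hw => ?_) (le_vSub _)
  obtain ⟨x₀, rfl⟩ := Submodule.mem_one.1 (vSub_coeI_le_one P hw)
  rw [mem_coeI]
  by_contra hx₀
  obtain ⟨M, hM, hPM⟩ := hPt.exists_isTMax hP.ne_top
  have hMp := hM.isPrime
  obtain ⟨m, hmM, hmP⟩ : ∃ m ∈ M, m ∉ P := by
    by_contra! hle
    exact hPnm (le_antisymm hPM hle ▸ hM)
  set x := x₀ * m with hx
  have hxP : x ∉ P := fun h => (hP.mem_or_mem h).elim hx₀ hmP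
  have hxM : x ∈ M := M.mul_mem_left _ hmM
  have hxv : algebraMap D (FractionRing D) x ∈ vSub D (coeI D P) := by
    rw [hx, mul_comm, map_mul, ← Algebra.smul_def]
    exact Submodule.smul_mem _ m hw
  obtain ⟨Q, hQ, hQM⟩ := Ideal.exists_minimalPrimes_le
    ((Ideal.span_singleton_le_iff_mem M).2 hxM)
  have hQp : Q.IsPrime := hQ.1.1
  have hxQ : x ∈ Q := (Ideal.span_singleton_le_iff_mem Q).1 hQ.1.2
  have hQ0 : Q ≠ ⊥ := by
    rintro rfl
    exact hxP (hxQ ▸ P.zero_mem)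
  have hQt := hPvMD.isTIdeal_of_le hQp hQ0 hM.1 hM.2.1 hQM
  have hPQ : P ≤ Q := fun p hp => by
    obtain ⟨c, s, hs, hc | hc⟩ := hPvMD.exists_mul_eq_mul hMp hM.2.1 p x
    · have : x * s ∈ P := hc ▸ P.mul_mem_right c hp
      exact ((hP.mem_or_mem this).elim hxP fun h => hs (hPM h)).elim
    · have : p * s ∈ Q := hc ▸ Q.mul_mem_right c hxQ
      exact (hQp.mem_or_mem this).resolve_right fun h => hs (hQM h)
  obtain ⟨z, hz, hzQ⟩ := Set.not_subset.1 (hds Q hQp hQ0 hQt)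
  simp only [Set.mem_iInter, Set.mem_ofPred_eq, and_imp] at hz
  obtain ⟨d, hdQ, hd⟩ := hPvMD.exists_notMem_locSet hQp hQt hxQ hzQ
  obtain ⟨n, hn⟩ := hPvMD.exists_mul_pow_notMem hQ hQt hdQ
  refine hn (mem_vSub.1 hxv _ (hPvMD.mem_one_div hP (pow_mem_locSet hP ?_ n) fun N hN hPN =>
    pow_mem_locSet hN.isPrime (mul_mem_locSet hN.isPrime (hz N hN fun h => hPN (hPQ.trans h))
      (mem_locSet_of_mem_one hN.isPrime (algebraMap_mem_one d))) n))
  obtain ⟨r, hr⟩ := Submodule.mem_one.1 hd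
  exact ⟨r, x, hxP, hr.symm⟩

end
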